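/- arXiv:0811.4570 — 13 statements merged into one kernel-verified Lean document; each statement's English description precedes it below -/
import Mathlib

section
/- Let γ ∈ [0,2], α = (4−3γ)/√6, and let V : ℝ → ℝ be continuously differentiable. Let (φ, x, y, z) : I → ℝ⁴ be a differentiable solution of system (S) on an interval I containing 0. Then the function G(τ) = V(φ(τ))·x(τ)² + (1/2)·y(τ)² + z(τ)² − 3 is differentiable on I and satisfies G′(τ) = −(y(τ)² + γ·z(τ)²)·G(τ) for all τ ∈ I; consequently, if G(0) = 0 then G(τ) = 0 for all τ ∈ I (the Hamiltonian constraint is invariant under the flow). -/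
open Real

/-- Invariance of the Hamiltonian constraint
`G = V(φ)x² + y²/2 + z² − 3` under the flow of the rescaled
collapsing flat-FRW scalar-field/perfect-fluid system (S). -/
theorem stmt_0
    (γ α : ℝ) (hγ : γ ∈ Set.Icc (0:ℝ) 2) (hα : α = (4 - 3*γ) / Real.sqrt 6)
    (V : ℝ → ℝ) (hV : ContDiff ℝ 1 V)
    (I : Set ℝ) (hI : I.OrdConnected) (h0 : (0:ℝ) ∈ I)
    (φ x y z : ℝ → ℝ)
    (hφ : ∀ τ ∈ I, HasDerivAt φ (-(y τ)) τ)
    (hx : ∀ τ ∈ I, HasDerivAt x (-(1/2) * x τ * ((y τ)^2 + γ * (z τ)^2)) τ)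
    (hy : ∀ τ ∈ I, HasDerivAt y
      (deriv V (φ τ) * (x τ)^2 + 3 * y τ - (1/2) * (y τ)^3
        - (z τ)^2 * (α + (γ/2) * y τ)) τ)
    (hz : ∀ τ ∈ I, HasDerivAt z
      (-(1/2) * z τ * ((y τ)^2 - α * y τ + γ * ((z τ)^2 - 3))) τ)
    (G : ℝ → ℝ)
    (hG : ∀ τ, G τ = V (φ τ) * (x τ)^2 + (1/2) * (y τ)^2 + (z τ)^2 - 3) :
    (∀ τ ∈ I, HasDerivAt G (-((y τ)^2 + γ * (z τ)^2) * G τ) τ) ∧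
      (G 0 = 0 → ∀ τ ∈ I, G τ = 0) := by
  have hd : ∀ τ ∈ I, HasDerivAt G (-((y τ)^2 + γ * (z τ)^2) * G τ) τ := by
    intro τ hτ
    have hVd : HasDerivAt V (deriv V (φ τ)) (φ τ) :=
      ((hV.differentiable (by norm_num)) (φ τ)).hasDerivAt
    have h1 : HasDerivAt (fun t => V (φ t)) (deriv V (φ τ) * (-(y τ))) τ :=
      hVd.comp τ (hφ τ hτ)
    have h2 := (((h1.mul ((hx τ hτ).pow 2)).add (((hy τ hτ).pow 2).const_mul (1/2))).add
      ((hz τ hτ).pow 2)).sub_const 3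
    have hGe : G = fun t => V (φ t) * (x t)^2 + (1/2) * (y t)^2 + (z t)^2 - 3 := funext hG
    rw [hGe]
    refine HasDerivAt.congr_deriv (f := fun t => V (φ t) * (x t)^2 + (1/2) * (y t)^2 + (z t)^2 - 3)
      h2 ?_
    simp only [Pi.pow_apply, Nat.cast_ofNat]
    ring
  refine ⟨hd, fun hG0 τ hτ => ?_⟩
  rcases le_total 0 τ with h | h
  · have hsub : Set.Icc 0 τ ⊆ I := hI.out h0 hτ
    have hder : ∀ t ∈ I, HasDerivAt (fun s => G s ^ 2)
        (-2 * ((y t)^2 + γ * (z t)^2) * G t ^ 2) t := fun t ht =>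
      ((hd t ht).fun_pow 2).congr_deriv (by push_cast; ring)
    have hanti : AntitoneOn (fun s => G s ^ 2) (Set.Icc 0 τ) := by
      refine antitoneOn_of_hasDerivWithinAt_nonpos (convex_Icc 0 τ)
        (fun t ht => (hder t (hsub ht)).continuousAt.continuousWithinAt)
        (fun t ht => (hder t (hsub (interior_subset ht))).hasDerivWithinAt) (fun t _ => ?_)
      have : 0 ≤ ((y t)^2 + γ * (z t)^2) * G t ^ 2 := by
        have := hγ.1
        positivity
      linarith
    have := hanti (Set.left_mem_Icc.2 h) (Set.right_mem_Icc.2 h) h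
    simp only [hG0] at this
    exact pow_eq_zero_iff (two_ne_zero) |>.1 (le_antisymm (by simpa using this) (sq_nonneg _))
  · have hsub : Set.Icc τ 0 ⊆ I := hI.out hτ h0
    have hcont : ContinuousOn (fun t => (y t)^2 + γ * (z t)^2) (Set.Icc τ 0) := fun t ht =>
      (((hy t (hsub ht)).continuousAt.pow 2).add
        (((hz t (hsub ht)).continuousAt.pow 2).const_mul γ)).continuousWithinAt
    obtain ⟨K, hK⟩ := isCompact_Icc.bddAbove_image hcont
    have hder : ∀ t ∈ I, HasDerivAt (fun s => G s ^ 2 * Real.exp (2 * K * s))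
        (2 * (K - ((y t)^2 + γ * (z t)^2)) * (G t ^ 2 * Real.exp (2 * K * t))) t := fun t ht =>
      (((hd t ht).fun_pow 2).fun_mul (((hasDerivAt_id' t).const_mul (2 * K)).exp)).congr_deriv
        (by push_cast; ring)
    have hmono : MonotoneOn (fun s => G s ^ 2 * Real.exp (2 * K * s)) (Set.Icc τ 0) := by
      refine monotoneOn_of_hasDerivWithinAt_nonneg (convex_Icc τ 0)
        (fun t ht => (hder t (hsub ht)).continuousAt.continuousWithinAt)
        (fun t ht => (hder t (hsub (interior_subset ht))).hasDerivWithinAt) (fun t ht => ?_)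
      have h1 : (y t)^2 + γ * (z t)^2 ≤ K := hK (Set.mem_image_of_mem _ (interior_subset ht))
      have h2 : 0 ≤ K - ((y t)^2 + γ * (z t)^2) := by linarith
      positivity
    have := hmono (Set.left_mem_Icc.2 h) (Set.right_mem_Icc.2 h) h
    simp only [hG0] at this
    have he := Real.exp_pos (2 * K * τ)
    by_contra hne
    have : 0 < G τ ^ 2 * Real.exp (2 * K * τ) := by positivity
    nlinarith
end

section
/- Fix γ ∈ [0,2], α = (4−3γ)/√6, and V : ℝ → ℝ continuously differentiable. Let T ∈ (0,∞] and let H, φ, ρ : [0,T) → ℝ be such that H is differentiable, φ is twice differentiable, ρ is differentiable, H(t) < 0 and ρ(t) > 0 for all t, and they satisfy Ḣ = −(1/2)φ̇² − (γ/2)ρ, φ̈ + 3Hφ̇ + V′(φ) = αρ, and ρ̇ + 3γρH = −αρφ̇ on [0,T). Define τ : [0,T) → ℝ by τ(t) = −∫₀ᵗ H(s) ds. Then τ is strictly increasing, maps [0,T) onto [0,S) for some S ∈ (0,∞], and, denoting by t(·) its inverse, the functions Φ(σ) = φ(t(σ)), X(σ) = 1/H(t(σ)), Y(σ) = φ̇(t(σ))/H(t(σ)),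 Z(σ) = √(ρ(t(σ)))/H(t(σ)) solve on [0,S) the system: Φ′ = −Y, X′ = −(1/2)X(Y² + γZ²), Y′ = V′(Φ)X² + 3Y − (1/2)Y³ − Z²(α + (γ/2)Y), Z′ = −(1/2)Z(Y² − αY + γ(Z² − 3)). -/
open Real Set

/-- passage from the flat FRW scalar-field/perfect-fluid
equations in comoving time `t` to the rescaled system in the new time
`τ(t) = -∫₀ᵗ H`.  The time change is strictly increasing, maps `[0,T)`
onto some `[0,S)` with `S ∈ (0,∞]`, and the rescaled variables
`Φ = φ∘t(·)`, `X = (1/H)∘t(·)`, `Y = (φ̇/H)∘t(·)`, `Z = (√ρ/H)∘t(·)`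
solve the compactified system. -/
theorem stmt_2
    (γ α : ℝ) (hγ : γ ∈ Set.Icc (0:ℝ) 2) (hα : α = (4 - 3*γ) / Real.sqrt 6)
    (V : ℝ → ℝ) (hV : ContDiff ℝ 1 V)
    (T : EReal) (hT : 0 < T)
    (D : Set ℝ) (hD : D = {t : ℝ | 0 ≤ t ∧ (t : EReal) < T})
    (H H' φ φ' φ'' ρ ρ' : ℝ → ℝ)
    (hHdiff : ∀ t ∈ D, HasDerivAt H (H' t) t)
    (hφdiff : ∀ t ∈ D, HasDerivAt φ (φ' t) t)
    (hφdiff2 : ∀ t ∈ D, HasDerivAt φ' (φ'' t) t)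
    (hρdiff : ∀ t ∈ D, HasDerivAt ρ (ρ' t) t)
    (hHneg : ∀ t ∈ D, H t < 0) (hρpos : ∀ t ∈ D, 0 < ρ t)
    (eqH : ∀ t ∈ D, H' t = -(1/2) * (φ' t)^2 - (γ/2) * ρ t)
    (eqφ : ∀ t ∈ D, φ'' t + 3 * H t * φ' t + deriv V (φ t) = α * ρ t)
    (eqρ : ∀ t ∈ D, ρ' t + 3 * γ * ρ t * H t = -α * ρ t * φ' t)
    (τ : ℝ → ℝ) (hτ : ∀ t, τ t = -∫ s in (0:ℝ)..t, H s) :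
    StrictMonoOn τ D ∧
    ∃ S : EReal, 0 < S ∧ τ '' D = {σ : ℝ | 0 ≤ σ ∧ (σ : EReal) < S} ∧
    ∃ tinv : ℝ → ℝ,
      (∀ t ∈ D, tinv (τ t) = t) ∧
      (∀ σ ∈ {σ : ℝ | 0 ≤ σ ∧ (σ : EReal) < S}, τ (tinv σ) = σ) ∧
      (∀ σ ∈ {σ : ℝ | 0 ≤ σ ∧ (σ : EReal) < S},
        HasDerivAt (fun σ' => φ (tinv σ')) (-(φ' (tinv σ) / H (tinv σ))) σ ∧
        HasDerivAt (fun σ' => 1 / H (tinv σ'))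
          (-(1/2) * (1 / H (tinv σ)) *
            ((φ' (tinv σ) / H (tinv σ))^2 + γ * (Real.sqrt (ρ (tinv σ)) / H (tinv σ))^2)) σ ∧
        HasDerivAt (fun σ' => φ' (tinv σ') / H (tinv σ'))
          (deriv V (φ (tinv σ)) * (1 / H (tinv σ))^2
            + 3 * (φ' (tinv σ) / H (tinv σ))
            - (1/2) * (φ' (tinv σ) / H (tinv σ))^3
            - (Real.sqrt (ρ (tinv σ)) / H (tinv σ))^2
              * (α + (γ/2) * (φ' (tinv σ) / H (tinv σ)))) σ ∧
        HasDerivAt (fun σ' => Real.sqrt (ρ (tinv σ')) / H (tinv σ'))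
          (-(1/2) * (Real.sqrt (ρ (tinv σ)) / H (tinv σ)) *
            ((φ' (tinv σ) / H (tinv σ))^2 - α * (φ' (tinv σ) / H (tinv σ))
              + γ * ((Real.sqrt (ρ (tinv σ)) / H (tinv σ))^2 - 3))) σ) := by
  subst hD
  set D : Set ℝ := {t : ℝ | 0 ≤ t ∧ (t : EReal) < T} with hDdef
  set U : Set ℝ := {t : ℝ | (t : EReal) < T} with hUdef
  have hDU : D ⊆ U := fun t ht => ht.2
  have h0D : (0:ℝ) ∈ D := ⟨le_rfl, by simpa using hT⟩
  have hUopen : IsOpen U := isOpen_lt continuous_coe_real_ereal continuous_const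
  have hUdown : ∀ a b : ℝ, a ≤ b → b ∈ U → a ∈ U := fun a b hab hb =>
    lt_of_le_of_lt (EReal.coe_le_coe_iff.2 hab) hb
  have hUconv : Convex ℝ U := by
    apply Set.OrdConnected.convex
    exact ⟨fun a _ b hb c hc => hUdown c b hc.2 hb⟩
  have hmaxD : ∀ t ∈ U, max t 0 ∈ D := by
    intro t ht
    refine ⟨le_max_right _ _, ?_⟩
    rcases max_choice t 0 with h | h
    · rw [h]; exact ht
    · rw [h]; exact h0D.2
  set G : ℝ → ℝ := fun t => - H (max t 0) with hG
  have hGpos : ∀ t ∈ U, 0 < G t := fun t ht => by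
    have := hHneg _ (hmaxD t ht)
    simp only [hG]; linarith
  have hGcont : ∀ t ∈ U, ContinuousAt G t := by
    intro t ht
    have h1 : ContinuousAt H (max t 0) := (hHdiff _ (hmaxD t ht)).continuousAt
    have h2 : ContinuousAt (fun t : ℝ => max t 0) t := by fun_prop
    exact (ContinuousAt.comp (f := fun t : ℝ => max t 0) h1 h2).neg
  have hGcontOn : ContinuousOn G U := fun t ht => (hGcont t ht).continuousWithinAt
  set f : ℝ → ℝ := fun t => ∫ s in (0:ℝ)..t, G s with hf
  have hfder : ∀ t ∈ U, HasStrictDerivAt f (G t) t := by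
    intro t ht
    apply intervalIntegral.integral_hasStrictDerivAt_right
    · apply ContinuousOn.intervalIntegrable
      apply hGcontOn.mono
      intro x hx
      exact hUconv.ordConnected.uIcc_subset (hDU h0D) ht hx
    · exact hGcontOn.stronglyMeasurableAtFilter hUopen t ht
    · exact hGcont t ht
  have hfmono : StrictMonoOn f U := by
    apply strictMonoOn_of_deriv_pos hUconv
    · exact fun t ht => (hfder t ht).hasDerivAt.continuousAt.continuousWithinAt
    · intro t ht
      have ht' := interior_subset ht
      rw [(hfder t ht').hasDerivAt.deriv]
      exact hGpos t ht'
  have hfτ : ∀ t ∈ D, τ t = f t := by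
    intro t ht
    rw [hτ, hf, ← intervalIntegral.integral_neg]
    apply intervalIntegral.integral_congr
    intro x hx
    rw [Set.uIcc_of_le ht.1] at hx
    simp only [hG, max_eq_left hx.1]
  have hf0 : f 0 = 0 := by simp [hf]
  have hτmono : StrictMonoOn τ D := by
    intro a ha b hb hab
    rw [hfτ a ha, hfτ b hb]
    exact hfmono (hDU ha) (hDU hb) hab
  have hbig : ∀ t ∈ D, ∃ u ∈ D, t < u := by
    intro t ht
    obtain ⟨u, h1, h2⟩ := EReal.lt_iff_exists_real_btwn.1 ht.2
    have h3 : t < u := EReal.coe_lt_coe_iff.1 h1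
    exact ⟨u, ⟨ht.1.trans h3.le, h2⟩, h3⟩
  set S : EReal := sSup ((fun x : ℝ => (x : EReal)) '' (τ '' D)) with hS
  have hltS : ∀ t ∈ D, ((τ t : ℝ) : EReal) < S := by
    intro t ht
    obtain ⟨u, hu, htu⟩ := hbig t ht
    refine lt_of_lt_of_le (EReal.coe_lt_coe_iff.2 (hτmono ht hu htu)) ?_
    exact le_sSup ⟨τ u, ⟨u, hu, rfl⟩, rfl⟩
  have hτ0 : τ 0 = 0 := by rw [hfτ 0 h0D, hf0]
  have himg : τ '' D = {σ : ℝ | 0 ≤ σ ∧ (σ : EReal) < S} := by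
    ext σ
    constructor
    · rintro ⟨t, ht, rfl⟩
      refine ⟨?_, hltS t ht⟩
      rw [← hτ0]
      exact hτmono.monotoneOn h0D ht ht.1
    · rintro ⟨h0, h1⟩
      obtain ⟨_, ⟨_, ⟨u, hu, rfl⟩, rfl⟩, h2⟩ := lt_sSup_iff.1 h1
      have h3 : σ < τ u := EReal.coe_lt_coe_iff.1 h2
      rw [hfτ u hu] at h3
      have hsub : Icc 0 u ⊆ U := fun x hx => hUdown x u hx.2 (hDU hu)
      have hc : ContinuousOn f (Icc 0 u) := fun x hx =>
        (hfder x (hsub hx)).hasDerivAt.continuousAt.continuousWithinAt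
      have := intermediate_value_Icc hu.1 hc
      obtain ⟨x, hx, hxσ⟩ := this ⟨by rw [hf0]; exact h0, h3.le⟩
      have hxD : x ∈ D := ⟨hx.1, hsub hx⟩
      exact ⟨x, hxD, by rw [hfτ x hxD, hxσ]⟩
  refine ⟨hτmono, S, ?_, himg, ?_⟩
  · have := hltS 0 h0D
    rw [hτ0] at this
    simpa using this
  set g : ℝ → ℝ := Function.invFunOn f U with hg
  have hgf : ∀ t ∈ U, g (f t) = t := fun t ht => hfmono.injOn.leftInvOn_invFunOn ht
  have hgD : ∀ t ∈ D, g (τ t) = t := fun t ht => by rw [hfτ t ht]; exact hgf t (hDU ht)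
  have hder : ∀ t ∈ D, HasDerivAt g (-(H t)⁻¹) (τ t) := by
    intro t ht
    have htU := hDU ht
    have hnhds : f '' U ∈ nhds (τ t) := by
      rw [hfτ t ht, ← (hfder t htU).map_nhds_eq (hGpos t htU).ne']
      exact Filter.image_mem_map (hUopen.mem_nhds htU)
    have hgmono : StrictMonoOn g (f '' U) := by
      rintro _ ⟨a, ha, rfl⟩ _ ⟨b, hb, rfl⟩ hab
      rw [hgf a ha, hgf b hb]
      exact (hfmono.lt_iff_lt ha hb).1 hab
    have hgimg : g '' (f '' U) = U := by
      ext x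
      constructor
      · rintro ⟨_, ⟨a, ha, rfl⟩, rfl⟩
        rw [hgf a ha]; exact ha
      · intro hx
        exact ⟨f x, ⟨x, hx, rfl⟩, hgf x hx⟩
    have hcont : ContinuousAt g (τ t) := by
      apply hgmono.continuousAt_of_image_mem_nhds hnhds
      rw [hgimg, hgD t ht]
      exact hUopen.mem_nhds htU
    have hG' : G t = - H t := by simp only [hG, max_eq_left ht.1]
    have := HasDerivAt.of_local_left_inverse (f := f) (f' := G t) hcont
      (by rw [hgD t ht]; exact (hfder t htU).hasDerivAt) (hGpos t htU).ne'
      (by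
        filter_upwards [hnhds]
        rintro _ ⟨a, ha, rfl⟩
        rw [hgf a ha])
    rwa [hG', inv_neg] at this
  refine ⟨g, hgD, ?_, ?_⟩
  · rw [← himg]
    rintro _ ⟨t, ht, rfl⟩
    rw [hgD t ht]
  rw [← himg]
  rintro _ ⟨t, ht, rfl⟩
  have hd := hder t ht
  have hgt := hgD t ht
  have hcomp : ∀ (F : ℝ → ℝ) (F' : ℝ), HasDerivAt F F' t →
      HasDerivAt (fun σ => F (g σ)) (F' * (-(H t)⁻¹)) (τ t) := by
    intro F F' hF
    have hF' : HasDerivAt F F' (g (τ t)) := by rw [hgt]; exact hF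
    exact hF'.comp (τ t) hd
  have hHt : H t ≠ 0 := (hHneg t ht).ne
  have hρt := hρpos t ht
  have hsq : Real.sqrt (ρ t) ^ 2 = ρ t := Real.sq_sqrt hρt.le
  have hsne : Real.sqrt (ρ t) ≠ 0 := (Real.sqrt_pos.2 hρt).ne'
  have e1 := eqH t ht
  have e2 : φ'' t = α * ρ t - 3 * H t * φ' t - deriv V (φ t) := by linarith [eqφ t ht]
  have e3 : ρ' t = -α * ρ t * φ' t - 3 * γ * ρ t * H t := by linarith [eqρ t ht]
  have dH := hHdiff t ht
  rw [hgt]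
  refine ⟨?_, ?_, ?_, ?_⟩
  · convert hcomp _ _ (hφdiff t ht) using 1
    field_simp
  · convert hcomp (fun u => 1 / H u) _ ((hasDerivAt_const t (1:ℝ)).div dH hHt) using 1
    rw [div_pow _ _ 2, div_pow _ _ 2, hsq, e1]
    field_simp
    ring
  · convert hcomp (fun u => φ' u / H u) _ ((hφdiff2 t ht).div dH hHt) using 1
    rw [div_pow (Real.sqrt _) _ 2, hsq, e1, e2]
    field_simp
    ring
  · convert hcomp (fun u => Real.sqrt (ρ u) / H u) _ (((hρdiff t ht).sqrt hρt.ne').div dH hHt) using 1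
    rw [e1, e3]
    generalize Real.sqrt (ρ t) = r at *
    rw [← hsq]
    field_simp
    ring
end

section
/- Fix real parameters γ ∈ [0,2] and u, and set α = (4−3γ)/√6. The planar vector field F vanishes at the point A = (−√6, 0), and the total derivative (Jacobian) of F at A is the diagonal linear map represented by the matrix diag(6(u−1), 3γ−5); in particular the eigenvalues of the linearization at A are 6(u−1) and 3γ−5. -/
open Real

/-- the boundary vector field `F` vanishes at
`A = (−√6, 0)` and its Jacobian there is `diag(6(u−1), 3γ−5)`;
in particular the eigenvalues of the linearization at `A` are
`6(u−1)` and `3γ−5`. -/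
theorem stmt_4
    (γ u α : ℝ) (hγ : γ ∈ Set.Icc (0:ℝ) 2) (hα : α = (4 - 3*γ) / Real.sqrt 6)
    (F : ℝ × ℝ → ℝ × ℝ)
    (hF : ∀ p : ℝ × ℝ, F p =
      ((3 - p.1^2/2) * (p.1 + Real.sqrt 6 * u)
          - p.2^2 * ((γ/2) * p.1 + α + Real.sqrt 6 * u),
        -(1/2) * p.2 * (p.1^2 - α * p.1 + γ * (p.2^2 - 3)))) :
    F (-Real.sqrt 6, 0) = 0 ∧
    ∃ L : ℝ × ℝ →L[ℝ] ℝ × ℝ,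
      HasFDerivAt F L (-Real.sqrt 6, 0) ∧
      (∀ v : ℝ × ℝ, L v = (6 * (u - 1) * v.1, (3*γ - 5) * v.2)) ∧
      Module.End.HasEigenvalue (L : ℝ × ℝ →ₗ[ℝ] ℝ × ℝ) (6 * (u - 1)) ∧
      Module.End.HasEigenvalue (L : ℝ × ℝ →ₗ[ℝ] ℝ × ℝ) (3*γ - 5) := by
  have h6 : Real.sqrt 6 * Real.sqrt 6 = 6 := Real.mul_self_sqrt (by norm_num)
  have hpos : Real.sqrt 6 ≠ 0 := by positivity
  have hα6 : α * Real.sqrt 6 = 4 - 3 * γ := by rw [hα]; field_simp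
  have hFe : F = fun p : ℝ × ℝ => ((3 - p.1^2/2) * (p.1 + Real.sqrt 6 * u)
          - p.2^2 * ((γ/2) * p.1 + α + Real.sqrt 6 * u),
        -(1/2) * p.2 * (p.1^2 - α * p.1 + γ * (p.2^2 - 3))) := funext hF
  refine ⟨?_, ?_⟩
  · rw [hF]
    ext
    · simp
      left
      norm_num
    · simp
  let L : ℝ × ℝ →L[ℝ] ℝ × ℝ :=
    ((6 * (u - 1)) • ContinuousLinearMap.fst ℝ ℝ ℝ).prod
      ((3 * γ - 5) • ContinuousLinearMap.snd ℝ ℝ ℝ)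
  have hL : ∀ v : ℝ × ℝ, L v = (6 * (u - 1) * v.1, (3*γ - 5) * v.2) := by
    intro v
    simp [L]
  refine ⟨L, ?_, hL, ?_, ?_⟩
  · have h1 : HasFDerivAt (fun p : ℝ × ℝ => p.1) (ContinuousLinearMap.fst ℝ ℝ ℝ)
        (-Real.sqrt 6, 0) := hasFDerivAt_fst
    have h2 : HasFDerivAt (fun p : ℝ × ℝ => p.2) (ContinuousLinearMap.snd ℝ ℝ ℝ)
        (-Real.sqrt 6, 0) := hasFDerivAt_snd
    have hy2 := h1.mul h1
    have hz2 := h2.mul h2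
    have hA := (((hy2.const_mul (1/2)).const_sub 3).mul (h1.add_const (Real.sqrt 6 * u))).sub
      (hz2.mul ((h1.const_mul (γ/2)).add_const (α + Real.sqrt 6 * u)))
    have hB := (h2.const_mul (-(1/2))).mul
      ((hy2.sub (h1.const_mul α)).add ((hz2.sub_const 3).const_mul γ))
    rw [hFe]
    refine ((hA.prodMk hB).congr_fderiv ?_).congr_of_eventuallyEq
      (Filter.Eventually.of_forall fun p => ?_)
    · refine ContinuousLinearMap.ext fun v => ?_
      rw [hL]
      ext
      · simp
        linear_combination (v.1 * (u - 1)) * h6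
      · simp
        linear_combination (-(1/2) * v.2) * hα6
    · ext
      · simp
        ring
      · simp
        left
        ring
  · refine Module.End.hasEigenvalue_of_hasEigenvector (x := ((1, 0) : ℝ × ℝ)) ?_
    refine ⟨Module.End.mem_eigenspace_iff.2 ?_, by simp⟩
    have := hL (1, 0)
    simpa using this
  · refine Module.End.hasEigenvalue_of_hasEigenvector (x := ((0, 1) : ℝ × ℝ)) ?_
    refine ⟨Module.End.mem_eigenspace_iff.2 ?_, by simp⟩
    have := hL (0, 1)
    simpa using this
end

section
/- Fix real parameters γ ∈ [0,2] and u, and set α = (4−3γ)/√6. The planar vector field F vanishes at the point B = (√6, 0), and the total derivative (Jacobian) of F at B is the diagonal linear map represented by the matrix diag(−6(1+u), −1); in particular the eigenvalues of the linearization at B are −6(1+u) and −1. -/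
open Real

/-- the boundary vector field `F` vanishes at
`B = (√6, 0)` and its Jacobian there is `diag(−6(1+u), −1)`;
in particular the eigenvalues of the linearization at `B` are
`−6(1+u)` and `−1`. -/
theorem stmt_5
    (γ u α : ℝ) (hγ : γ ∈ Set.Icc (0:ℝ) 2) (hα : α = (4 - 3*γ) / Real.sqrt 6)
    (F : ℝ × ℝ → ℝ × ℝ)
    (hF : ∀ p : ℝ × ℝ, F p =
      ((3 - p.1^2/2) * (p.1 + Real.sqrt 6 * u)
          - p.2^2 * ((γ/2) * p.1 + α + Real.sqrt 6 * u),
        -(1/2) * p.2 * (p.1^2 - α * p.1 + γ * (p.2^2 - 3)))) :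
    F (Real.sqrt 6, 0) = 0 ∧
    ∃ L : ℝ × ℝ →L[ℝ] ℝ × ℝ,
      HasFDerivAt F L (Real.sqrt 6, 0) ∧
      (∀ v : ℝ × ℝ, L v = (-6 * (1 + u) * v.1, -1 * v.2)) ∧
      Module.End.HasEigenvalue (L : ℝ × ℝ →ₗ[ℝ] ℝ × ℝ) (-6 * (1 + u)) ∧
      Module.End.HasEigenvalue (L : ℝ × ℝ →ₗ[ℝ] ℝ × ℝ) (-1) := by
  have h6 : Real.sqrt 6 ^ 2 = 6 := Real.sq_sqrt (by norm_num)
  have h6pos : Real.sqrt 6 ≠ 0 := by positivity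
  have hα' : α * Real.sqrt 6 = 4 - 3 * γ := by rw [hα]; field_simp
  have hFe : F = fun p : ℝ × ℝ =>
      ((3 - p.1^2/2) * (p.1 + Real.sqrt 6 * u)
          - p.2^2 * ((γ/2) * p.1 + α + Real.sqrt 6 * u),
        -(1/2) * p.2 * (p.1^2 - α * p.1 + γ * (p.2^2 - 3))) := funext hF
  let L : ℝ × ℝ →L[ℝ] ℝ × ℝ :=
    ((-6 * (1 + u)) • ContinuousLinearMap.fst ℝ ℝ ℝ).prod
      ((-1 : ℝ) • ContinuousLinearMap.snd ℝ ℝ ℝ)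
  have hL : ∀ v : ℝ × ℝ, L v = (-6 * (1 + u) * v.1, -1 * v.2) := fun v => by
    simp [L]
  refine ⟨?_, L, ?_, hL, ?_, ?_⟩
  · rw [hF]
    ext
    · simp [h6]
      left; norm_num
    · simp
  · have a : HasFDerivAt (fun p : ℝ × ℝ => p.1) (ContinuousLinearMap.fst ℝ ℝ ℝ)
        (Real.sqrt 6, (0:ℝ)) := hasFDerivAt_fst
    have b : HasFDerivAt (fun p : ℝ × ℝ => p.2) (ContinuousLinearMap.snd ℝ ℝ ℝ)
        (Real.sqrt 6, (0:ℝ)) := hasFDerivAt_snd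
    rw [hFe]
    have h1 := ((((a.mul a).mul_const (1/2)).const_sub 3).mul
      (a.add_const (Real.sqrt 6 * u))).sub
      ((b.mul b).mul (((a.const_mul (γ/2)).add_const α).add_const (Real.sqrt 6 * u)))
    have h2 := (b.const_mul (-(1/2))).mul
      (((a.mul a).sub (a.const_mul α)).add (((b.mul b).sub_const 3).const_mul γ))
    have h := h1.prodMk h2
    refine (h.congr_fderiv ?_).congr_of_eventuallyEq (Filter.Eventually.of_forall ?_)
    · apply ContinuousLinearMap.ext
      intro v
      rw [hL]
      ext
      · simp
        linear_combination (-1 * v.1 - u * v.1) * h6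
      · simp
        linear_combination (-1/2 * v.2) * hα'
    · intro p
      ext
      · simp; ring
      · simp only [Pi.mul_apply, Pi.add_apply, Pi.sub_apply]; ring
  · apply Module.End.hasEigenvalue_of_hasEigenvector (x := ((1, 0) : ℝ × ℝ))
    rw [Module.End.hasEigenvector_iff, Module.End.mem_eigenspace_iff]
    refine ⟨?_, by simp⟩
    change L _ = _
    rw [hL]; simp
  · apply Module.End.hasEigenvalue_of_hasEigenvector (x := ((0, 1) : ℝ × ℝ))
    rw [Module.End.hasEigenvector_iff, Module.End.mem_eigenspace_iff]
    refine ⟨?_, by simp⟩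
    change L _ = _
    rw [hL]; simp
end

section
/- Fix real parameters γ ∈ [0,2] and u, and set α = (4−3γ)/√6. The planar vector field F vanishes at the point C = (−√6·u, 0), and the total derivative (Jacobian) of F at C is the diagonal linear map represented by the matrix diag(3(1−u²), (1/2)(3γ − 4u + 3γu − 6u²)); in particular the eigenvalues of the linearization at C are 3(1−u²) and (1/2)(3γ − 4u + 3γu − 6u²). -/
open Real

/-- the boundary vector field `F` vanishes at
`C = (−√6·u, 0)` and its Jacobian there is
`diag(3(1−u²), (1/2)(3γ − 4u + 3γu − 6u²))`; in particular the
eigenvalues of the linearization at `C` are `3(1−u²)` and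
`(1/2)(3γ − 4u + 3γu − 6u²)`. -/
theorem stmt_6
    (γ u α : ℝ) (hγ : γ ∈ Set.Icc (0:ℝ) 2) (hα : α = (4 - 3*γ) / Real.sqrt 6)
    (F : ℝ × ℝ → ℝ × ℝ)
    (hF : ∀ p : ℝ × ℝ, F p =
      ((3 - p.1^2/2) * (p.1 + Real.sqrt 6 * u)
          - p.2^2 * ((γ/2) * p.1 + α + Real.sqrt 6 * u),
        -(1/2) * p.2 * (p.1^2 - α * p.1 + γ * (p.2^2 - 3)))) :
    F (-Real.sqrt 6 * u, 0) = 0 ∧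
    ∃ L : ℝ × ℝ →L[ℝ] ℝ × ℝ,
      HasFDerivAt F L (-Real.sqrt 6 * u, 0) ∧
      (∀ v : ℝ × ℝ, L v =
        (3 * (1 - u^2) * v.1, (1/2) * (3*γ - 4*u + 3*γ*u - 6*u^2) * v.2)) ∧
      Module.End.HasEigenvalue (L : ℝ × ℝ →ₗ[ℝ] ℝ × ℝ) (3 * (1 - u^2)) ∧
      Module.End.HasEigenvalue (L : ℝ × ℝ →ₗ[ℝ] ℝ × ℝ)
        ((1/2) * (3*γ - 4*u + 3*γ*u - 6*u^2)) := by
  have h6 : Real.sqrt 6 ^ 2 = 6 := Real.sq_sqrt (by norm_num)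
  have hs : Real.sqrt 6 ≠ 0 := by positivity
  have hα' : α * Real.sqrt 6 = 4 - 3 * γ := by
    rw [hα]; field_simp
  refine ⟨?_, ?_⟩
  · rw [hF]; ext <;> simp
  let f := ContinuousLinearMap.fst ℝ ℝ ℝ
  let g := ContinuousLinearMap.snd ℝ ℝ ℝ
  let L : ℝ × ℝ →L[ℝ] ℝ × ℝ :=
    ((3 * (1 - u^2)) • f).prod (((1/2) * (3*γ - 4*u + 3*γ*u - 6*u^2)) • g)
  have hL : ∀ v : ℝ × ℝ, L v =
      (3 * (1 - u^2) * v.1, (1/2) * (3*γ - 4*u + 3*γ*u - 6*u^2) * v.2) := by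
    intro v; simp [L, f, g]
  refine ⟨L, ?_, hL, ?_, ?_⟩
  · have hFe : F = fun p : ℝ × ℝ => ((3 - p.1^2/2) * (p.1 + Real.sqrt 6 * u)
          - p.2^2 * ((γ/2) * p.1 + α + Real.sqrt 6 * u),
        -(1/2) * p.2 * (p.1^2 - α * p.1 + γ * (p.2^2 - 3))) := funext hF
    rw [hFe]
    have h1 : HasFDerivAt (fun p : ℝ × ℝ => p.1) f (-Real.sqrt 6 * u, 0) := hasFDerivAt_fst
    have h2 : HasFDerivAt (fun p : ℝ × ℝ => p.2) g (-Real.sqrt 6 * u, 0) := hasFDerivAt_snd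
    have hA := ((((h1.pow 2).mul_const (1/2)).const_sub 3).mul
      (h1.add_const (Real.sqrt 6 * u))).sub
      ((h2.pow 2).mul (((h1.const_mul (γ/2)).add_const α).add_const (Real.sqrt 6 * u)))
    have hB := (h2.const_mul (-(1/2))).mul
      (((h1.pow 2).sub (h1.const_mul α)).add (((h2.pow 2).sub_const 3).const_mul γ))
    have hAB := hA.prodMk hB
    refine (hAB.congr_fderiv ?_).congr_of_eventuallyEq (Filter.Eventually.of_forall ?_)
    · refine ContinuousLinearMap.ext fun v => ?_
      rw [hL]
      refine Prod.ext ?_ ?_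
      · simp [f, g]
        left
        linear_combination (-(1/2) * u^2) * h6
      · simp [f, g]
        linear_combination (-(1/2) * u^2 * v.2) * h6 - (1/2) * u * v.2 * hα'
    · intro p
      refine Prod.ext ?_ ?_ <;> simp [-mul_eq_mul_right_iff, -mul_eq_mul_left_iff, -sub_left_inj] <;> ring
  · refine Module.End.hasEigenvalue_of_hasEigenvector (x := ((1 : ℝ), (0 : ℝ))) ⟨?_, by simp⟩
    rw [Module.End.mem_eigenspace_iff]
    simp [hL]
  · refine Module.End.hasEigenvalue_of_hasEigenvector (x := ((0 : ℝ), (1 : ℝ))) ⟨?_, by simp⟩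
    rw [Module.End.mem_eigenspace_iff]
    simp [hL]
end

section
/- Fix real parameters γ and u with 0 ≤ γ < 5/3, and set α = (4−3γ)/√6. Let y_D = 2α/(2−γ) and z_D = 2√(5−3γ)/(√3·(2−γ)). Then the point (y_D, z_D) lies on the circle (1/2)y² + z² = 3 (that is, z_D² = 4(5−3γ)/(3(2−γ)²) = 3 − (1/2)y_D²), and the planar vector field F vanishes at both (y_D, z_D) and (y_D, −z_D). -/
open Real

/-- for `0 ≤ γ < 5/3` the points
`D± = (2α/(2−γ), ±z_D)` with `z_D = 2√(5−3γ)/(√3(2−γ))` lie on the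
boundary circle `(1/2)y² + z² = 3` and are equilibria of the boundary
vector field `F`. -/
theorem stmt_7
    (γ u α : ℝ) (hγ0 : 0 ≤ γ) (hγ53 : γ < 5/3)
    (hα : α = (4 - 3*γ) / Real.sqrt 6)
    (F : ℝ × ℝ → ℝ × ℝ)
    (hF : ∀ p : ℝ × ℝ, F p =
      ((3 - p.1^2/2) * (p.1 + Real.sqrt 6 * u)
          - p.2^2 * ((γ/2) * p.1 + α + Real.sqrt 6 * u),
        -(1/2) * p.2 * (p.1^2 - α * p.1 + γ * (p.2^2 - 3))))
    (yD zD : ℝ)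
    (hyD : yD = 2*α / (2 - γ))
    (hzD : zD = 2 * Real.sqrt (5 - 3*γ) / (Real.sqrt 3 * (2 - γ))) :
    zD^2 = 4*(5 - 3*γ) / (3*(2 - γ)^2) ∧
    zD^2 = 3 - (1/2) * yD^2 ∧
    F (yD, zD) = 0 ∧ F (yD, -zD) = 0 := by
  have hg : (2 - γ) ≠ 0 := by
    intro h
    linarith
  have h6 : Real.sqrt 6 ^ 2 = 6 := Real.sq_sqrt (by norm_num)
  have h3 : Real.sqrt 3 ^ 2 = 3 := Real.sq_sqrt (by norm_num)
  have h5 : Real.sqrt (5 - 3*γ) ^ 2 = 5 - 3*γ := Real.sq_sqrt (by linarith)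
  have hα2 : α^2 = (4 - 3*γ)^2 / 6 := by rw [hα, div_pow, h6]
  have hz1 : zD^2 = 4*(5 - 3*γ) / (3*(2 - γ)^2) := by
    rw [hzD, div_pow, mul_pow, mul_pow, h3, h5]
    norm_num
  have hz2 : zD^2 = 3 - (1/2) * yD^2 := by
    rw [hz1, hyD, div_pow, mul_pow, hα2]
    field_simp
    ring
  have hy : α = yD * (2 - γ) / 2 := by
    rw [hyD]
    field_simp
  have e1 : (3 - yD^2/2) * (yD + Real.sqrt 6 * u)
      - zD^2 * ((γ/2) * yD + α + Real.sqrt 6 * u) = 0 := by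
    rw [hz2, hy]
    ring
  have e2 : yD^2 - α * yD + γ * (zD^2 - 3) = 0 := by
    rw [hz2, hy]
    ring
  refine ⟨hz1, hz2, ?_, ?_⟩
  · rw [hF]
    ext
    · exact e1
    · simp only [e2, mul_zero, Prod.snd_zero]
  · rw [hF]
    ext
    · simp only [neg_sq, e1, Prod.fst_zero]
    · simp only [neg_sq, e2, mul_zero, Prod.snd_zero]
end

section
/- Let γ = 4/3 (so α = 0) and let u be any real number. Then for each sign ε ∈ {1, −1}, the planar vector field F vanishes at the point (0, ε√3), and the total derivative (Jacobian) of F at (0, ε√3) is the linear map represented by the upper-triangular matrix with rows (1, −6√2·ε·u) and (0, −4); in particular the eigenvalues of the linearization at (0, ±√3) are 1 and −4. -/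
open Real

/-- for `γ = 4/3` (so `α = 0`) the boundary vector field
`F` vanishes at every point `(0, ε√3)` with `ε = ±1`, and its Jacobian
there is the upper-triangular matrix with rows `(1, −6√2·ε·u)` and
`(0, −4)`; in particular the eigenvalues of the linearization at
`(0, ±√3)` are `1` and `−4`. -/
theorem stmt_8
    (γ u α : ℝ) (hγ : γ = 4/3) (hα : α = (4 - 3*γ) / Real.sqrt 6)
    (F : ℝ × ℝ → ℝ × ℝ)
    (hF : ∀ p : ℝ × ℝ, F p =
      ((3 - p.1^2/2) * (p.1 + Real.sqrt 6 * u)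
          - p.2^2 * ((γ/2) * p.1 + α + Real.sqrt 6 * u),
        -(1/2) * p.2 * (p.1^2 - α * p.1 + γ * (p.2^2 - 3))))
    (ε : ℝ) (hε : ε = 1 ∨ ε = -1) :
    F (0, ε * Real.sqrt 3) = 0 ∧
    ∃ L : ℝ × ℝ →L[ℝ] ℝ × ℝ,
      HasFDerivAt F L (0, ε * Real.sqrt 3) ∧
      (∀ v : ℝ × ℝ, L v =
        (1 * v.1 + (-6 * Real.sqrt 2 * ε * u) * v.2, -4 * v.2)) ∧
      Module.End.HasEigenvalue (L : ℝ × ℝ →ₗ[ℝ] ℝ × ℝ) 1 ∧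
      Module.End.HasEigenvalue (L : ℝ × ℝ →ₗ[ℝ] ℝ × ℝ) (-4) := by
  have hα0 : α = 0 := by rw [hα, hγ]; norm_num
  subst hα0
  subst hγ
  have hε2 : ε ^ 2 = 1 := by rcases hε with h | h <;> rw [h] <;> norm_num
  have h3 : Real.sqrt 3 ^ 2 = 3 := Real.sq_sqrt (by norm_num)
  have h6 : Real.sqrt 6 = Real.sqrt 3 * Real.sqrt 2 := by
    rw [← Real.sqrt_mul (by norm_num)]; norm_num
  have hz : (ε * Real.sqrt 3) ^ 2 = 3 := by rw [mul_pow, hε2, h3]; norm_num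
  have hc : 2 * (ε * Real.sqrt 3) * (Real.sqrt 6 * u) = 6 * Real.sqrt 2 * ε * u := by
    rw [h6]; linear_combination (2 * ε * Real.sqrt 2 * u) * h3
  generalize hzd : ε * Real.sqrt 3 = z at *
  have key : ∀ L : ℝ × ℝ →L[ℝ] ℝ × ℝ, (∀ v : ℝ × ℝ, L v =
        (1 * v.1 + (-6 * Real.sqrt 2 * ε * u) * v.2, -4 * v.2)) →
        HasFDerivAt F L (0, z) := by
    intro L hL
    have hFe : F = fun p : ℝ × ℝ => ((3 - p.1^2*(1/2)) * (p.1 + Real.sqrt 6 * u)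
          - p.2^2 * ((2/3) * p.1 + Real.sqrt 6 * u),
        (-(1/2) * p.2) * (p.1^2 + (4/3) * (p.2^2 - 3))) := by
      funext p
      rw [hF p]
      ext <;> simp only [] <;> ring
    rw [hFe]
    have f1 : HasFDerivAt (fun p : ℝ × ℝ => p.1) (ContinuousLinearMap.fst ℝ ℝ ℝ) ((0 : ℝ), z) :=
      hasFDerivAt_fst
    have f2 : HasFDerivAt (fun p : ℝ × ℝ => p.2) (ContinuousLinearMap.snd ℝ ℝ ℝ) ((0 : ℝ), z) :=
      hasFDerivAt_snd
    have a := ((((f1.pow 2).mul_const (1/2)).const_sub 3).mul (f1.add_const (Real.sqrt 6 * u))).sub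
      ((f2.pow 2).mul ((f1.const_mul (2/3)).add_const (Real.sqrt 6 * u)))
    have b := (f2.const_mul (-(1/2))).mul
      ((f1.pow 2).add (((f2.pow 2).sub_const 3).const_mul (4/3)))
    refine (a.prodMk b).congr_fderiv ?_
    refine ContinuousLinearMap.ext fun v => ?_
    rw [hL]
    ext
    · simp
      linear_combination (-(2/3) * v.1) * hz - v.2 * hc
    · simp
      linear_combination (-2 * v.2) * hz
  refine ⟨?_, (ContinuousLinearMap.fst ℝ ℝ ℝ + (-6 * Real.sqrt 2 * ε * u) •
    ContinuousLinearMap.snd ℝ ℝ ℝ).prod ((-4 : ℝ) • ContinuousLinearMap.snd ℝ ℝ ℝ),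
    key _ ?_, ?_, ?_, ?_⟩
  · rw [hF]
    simp only [hz]
    ext <;> simp
  · intro v
    ext <;> simp
  · intro v
    ext <;> simp
  · refine Module.End.hasEigenvalue_of_hasEigenvector (x := ((1 : ℝ), (0 : ℝ))) ⟨?_, by simp⟩
    rw [Module.End.mem_eigenspace_iff]
    ext <;> simp
  · refine Module.End.hasEigenvalue_of_hasEigenvector
      (x := ((6 * Real.sqrt 2 * ε * u / 5 : ℝ), (1 : ℝ))) ⟨?_, by simp⟩
    rw [Module.End.mem_eigenspace_iff]
    ext
    · simp
      ring
    · simp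
end

section
/- Let V : ℝ → ℝ be twice continuously differentiable and let γ = 4/3. Define the vector field G : ℝ³ → ℝ³ by G(φ, x, y) = ( −y, −(1/2)x(y² + (4/3)(3 − V(φ)x² − (1/2)y²)), V′(φ)x² + 3y − (1/2)y³ − (2/3)y(3 − V(φ)x² − (1/2)y²) ). Then for every φ₀ ∈ ℝ, G(φ₀, 0, 0) = 0 and the total derivative of G at (φ₀, 0, 0) is the linear map represented by the matrix with rows (0, 0, −1), (0, −2, 0), (0, 0, 1); in particular its eigenvalues are 0, −2, and 1, so the linearization has an eigenvalue with positive real part (these equilibria have an unstable manifold of positive dimension). -/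
open Real

/-- for `γ = 4/3` the unconstrained vector field `G`
(obtained by eliminating `z` via the Hamiltonian constraint) vanishes
at every point `(φ₀, 0, 0)`, and its Jacobian there has rows
`(0,0,−1)`, `(0,−2,0)`, `(0,0,1)`; in particular its eigenvalues are
`0`, `−2` and `1`, so there is an eigenvalue with positive real part
(the equilibria have an unstable manifold of positive dimension). -/
theorem stmt_11
    (V : ℝ → ℝ) (hV : ContDiff ℝ 2 V)
    (G : ℝ × ℝ × ℝ → ℝ × ℝ × ℝ)
    (hG : ∀ p : ℝ × ℝ × ℝ, G p =
      (-p.2.2,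
       -(1/2) * p.2.1 * (p.2.2^2 + (4/3) * (3 - V p.1 * p.2.1^2 - (1/2) * p.2.2^2)),
       deriv V p.1 * p.2.1^2 + 3 * p.2.2 - (1/2) * p.2.2^3
         - (2/3) * p.2.2 * (3 - V p.1 * p.2.1^2 - (1/2) * p.2.2^2))) :
    ∀ φ₀ : ℝ,
      G (φ₀, 0, 0) = 0 ∧
      ∃ L : ℝ × ℝ × ℝ →L[ℝ] ℝ × ℝ × ℝ,
        HasFDerivAt G L (φ₀, 0, 0) ∧
        (∀ v : ℝ × ℝ × ℝ, L v = (-v.2.2, -2 * v.2.1, v.2.2)) ∧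
        Module.End.HasEigenvalue (L : ℝ × ℝ × ℝ →ₗ[ℝ] ℝ × ℝ × ℝ) 0 ∧
        Module.End.HasEigenvalue (L : ℝ × ℝ × ℝ →ₗ[ℝ] ℝ × ℝ × ℝ) (-2) ∧
        Module.End.HasEigenvalue (L : ℝ × ℝ × ℝ →ₗ[ℝ] ℝ × ℝ × ℝ) 1 ∧
        ∃ μ : ℝ, 0 < μ ∧
          Module.End.HasEigenvalue (L : ℝ × ℝ × ℝ →ₗ[ℝ] ℝ × ℝ × ℝ) μ := by
  intro φ₀
  have hV1 : Differentiable ℝ V := hV.differentiable (by norm_num)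
  have hV2 : Differentiable ℝ (deriv V) :=
    ((contDiff_succ_iff_deriv (n := 1)).1 (by simpa [one_add_one_eq_two] using hV)).2.2.differentiable
      (by norm_num)
  let q : ℝ × ℝ × ℝ := (φ₀, 0, 0)
  let a : ℝ × ℝ × ℝ →L[ℝ] ℝ := ContinuousLinearMap.fst ℝ ℝ (ℝ × ℝ)
  let b : ℝ × ℝ × ℝ →L[ℝ] ℝ :=
    (ContinuousLinearMap.fst ℝ ℝ ℝ).comp (ContinuousLinearMap.snd ℝ ℝ (ℝ × ℝ))
  let c : ℝ × ℝ × ℝ →L[ℝ] ℝ :=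
    (ContinuousLinearMap.snd ℝ ℝ ℝ).comp (ContinuousLinearMap.snd ℝ ℝ (ℝ × ℝ))
  have ha : HasFDerivAt (fun p : ℝ × ℝ × ℝ => p.1) a q := a.hasFDerivAt
  have hb : HasFDerivAt (fun p : ℝ × ℝ × ℝ => p.2.1) b q := b.hasFDerivAt
  have hc : HasFDerivAt (fun p : ℝ × ℝ × ℝ => p.2.2) c q := c.hasFDerivAt
  have hv : HasFDerivAt (fun p : ℝ × ℝ × ℝ => V p.1) (deriv V φ₀ • a) q :=
    HasDerivAt.comp_hasFDerivAt q (hV1 φ₀).hasDerivAt ha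
  have hw : HasFDerivAt (fun p : ℝ × ℝ × ℝ => deriv V p.1) (deriv (deriv V) φ₀ • a) q :=
    HasDerivAt.comp_hasFDerivAt (h₂ := deriv V) q (hV2 φ₀).hasDerivAt ha
  have hz := ((hv.mul (hb.pow 2)).const_sub 3).sub ((hc.pow 2).const_mul (1/2))
  have h2 := (hb.const_mul (-(1/2))).mul ((hc.pow 2).add (hz.const_mul (4/3)))
  have h3 := (((hw.mul (hb.pow 2)).add (hc.const_mul 3)).sub ((hc.pow 3).const_mul (1/2))).sub
    ((hc.const_mul (2/3)).mul hz)
  have hL : HasFDerivAt G ((-c).prod (((-2 : ℝ) • b).prod c)) q := by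
    have hGe : G = _ := funext hG
    rw [hGe]
    refine hc.neg.prodMk (HasFDerivAt.prodMk ?_ ?_)
    · refine h2.congr_fderiv ?_
      ext <;> simp [q, a, b, c] <;> norm_num
    · refine h3.congr_fderiv ?_
      ext <;> simp [q, a, b, c] <;> norm_num
  have hLv : ∀ v : ℝ × ℝ × ℝ,
      ((-c).prod (((-2 : ℝ) • b).prod c)) v = (-v.2.2, -2 * v.2.1, v.2.2) := by
    intro v
    simp [b, c]
  have e1 : Module.End.HasEigenvalue
      (((-c).prod (((-2 : ℝ) • b).prod c) : ℝ × ℝ × ℝ →L[ℝ] ℝ × ℝ × ℝ) :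
        ℝ × ℝ × ℝ →ₗ[ℝ] ℝ × ℝ × ℝ) 1 := by
    refine Module.End.hasEigenvalue_of_hasEigenvector (x := (-1, 0, 1))
      ⟨Module.End.mem_eigenspace_iff.2 ?_, by simp⟩
    refine (hLv _).trans ?_
    simp
  refine ⟨by rw [hG]; simp, _, hL, hLv, ?_, ?_, e1, 1, one_pos, e1⟩
  · refine Module.End.hasEigenvalue_of_hasEigenvector (x := (1, 0, 0))
      ⟨Module.End.mem_eigenspace_iff.2 ?_, by simp⟩
    refine (hLv _).trans ?_
    simp
  · refine Module.End.hasEigenvalue_of_hasEigenvector (x := (0, 1, 0))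
      ⟨Module.End.mem_eigenspace_iff.2 ?_, by simp⟩
    refine (hLv _).trans ?_
    simp
end

section
/- Let γ ∈ [0,2], α = (4−3γ)/√6, and let V : ℝ → ℝ be twice continuously differentiable. Let φ₀ ∈ ℝ satisfy V′(φ₀) = 0 and V(φ₀) > 0. Define, on the open set of (φ, v, ρ) ∈ ℝ³ where ρ + (1/2)v² + V(φ) > 0, the vector field G(φ, v, ρ) = ( v, √(3(ρ + (1/2)v² + V(φ)))·v − V′(φ) + αρ, −ρ(αv + γ√(3(ρ + (1/2)v² + V(φ)))) ). Then G(φ₀, 0, 0) = 0, the total derivative of G at (φ₀, 0, 0) is represented by the matrix with rows (0, 1, 0), (−V″(φ₀), √(3V(φ₀)), α), (0, 0, −γ√(3V(φ₀))), and this matrix, regarded as a complex matrix, has at least one eigenvalue with strictly positive real part (its eigenvalues are −γ√(3V(φ₀)) and (1/2)(√(3V(φ₀)) ± √(3V(φ₀) − 4V″(φ₀)))). -/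
open Real

/-- instability of the equilibrium `(φ₀, 0, 0)`
(with `V′(φ₀) = 0`, `V(φ₀) > 0`) of the flat FRW
scalar-field/perfect-fluid system written in the variables
`(φ, v, ρ)`.  The Jacobian there has rows `(0,1,0)`,
`(−V″(φ₀), √(3V(φ₀)), α)`, `(0,0,−γ√(3V(φ₀)))`, and, regarded as a
complex matrix, it has at least one eigenvalue with strictly positive
real part. -/
theorem stmt_12
    (γ α : ℝ) (hγ : γ ∈ Set.Icc (0:ℝ) 2) (hα : α = (4 - 3*γ) / Real.sqrt 6)
    (V : ℝ → ℝ) (hV : ContDiff ℝ 2 V)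
    (φ₀ : ℝ) (hV' : deriv V φ₀ = 0) (hVpos : 0 < V φ₀)
    (G : ℝ × ℝ × ℝ → ℝ × ℝ × ℝ)
    (hG : ∀ p : ℝ × ℝ × ℝ, G p =
      (p.2.1,
       Real.sqrt (3 * (p.2.2 + (1/2) * p.2.1^2 + V p.1)) * p.2.1
         - deriv V p.1 + α * p.2.2,
       -p.2.2 * (α * p.2.1
         + γ * Real.sqrt (3 * (p.2.2 + (1/2) * p.2.1^2 + V p.1))))) :
    G (φ₀, 0, 0) = 0 ∧
    (∃ L : ℝ × ℝ × ℝ →L[ℝ] ℝ × ℝ × ℝ,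
      HasFDerivAt G L (φ₀, 0, 0) ∧
      ∀ v : ℝ × ℝ × ℝ, L v =
        (v.2.1,
         -(deriv (deriv V) φ₀) * v.1 + Real.sqrt (3 * V φ₀) * v.2.1 + α * v.2.2,
         -(γ * Real.sqrt (3 * V φ₀)) * v.2.2)) ∧
    (∃ μ : ℂ, 0 < μ.re ∧
      Module.End.HasEigenvalue
        (Matrix.toLin'
          (!![(0 : ℂ), 1, 0;
              Complex.ofReal (-(deriv (deriv V) φ₀)),
                Complex.ofReal (Real.sqrt (3 * V φ₀)), Complex.ofReal α;
              0, 0, Complex.ofReal (-(γ * Real.sqrt (3 * V φ₀)))])) μ) := by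
  have hdV : Differentiable ℝ V := hV.differentiable (by norm_num)
  have hddV : Differentiable ℝ (deriv V) :=
    (ContDiff.differentiable_deriv_two hV)
  refine ⟨?_, ?_, ?_⟩
  · rw [hG]
    simp [hV']
  · have hS : DifferentiableAt ℝ (fun p : ℝ × ℝ × ℝ =>
        Real.sqrt (3 * (p.2.2 + (1/2) * p.2.1^2 + V p.1))) (φ₀, 0, 0) := by
      apply DifferentiableAt.sqrt
      · fun_prop
      · simp [hVpos.ne']
    have h1 : HasFDerivAt (fun p : ℝ × ℝ × ℝ => p.2.1)
        ((ContinuousLinearMap.fst ℝ ℝ ℝ).comp (ContinuousLinearMap.snd ℝ ℝ (ℝ × ℝ)))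
        (φ₀, 0, 0) :=
      ((ContinuousLinearMap.fst ℝ ℝ ℝ).comp
        (ContinuousLinearMap.snd ℝ ℝ (ℝ × ℝ))).hasFDerivAt
    have h2 : HasFDerivAt (fun p : ℝ × ℝ × ℝ => p.2.2)
        ((ContinuousLinearMap.snd ℝ ℝ ℝ).comp (ContinuousLinearMap.snd ℝ ℝ (ℝ × ℝ)))
        (φ₀, 0, 0) :=
      ((ContinuousLinearMap.snd ℝ ℝ ℝ).comp
        (ContinuousLinearMap.snd ℝ ℝ (ℝ × ℝ))).hasFDerivAt
    have h0 : HasFDerivAt (fun p : ℝ × ℝ × ℝ => p.1)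
        (ContinuousLinearMap.fst ℝ ℝ (ℝ × ℝ)) (φ₀, 0, 0) :=
      (ContinuousLinearMap.fst ℝ ℝ (ℝ × ℝ)).hasFDerivAt
    have hD : HasFDerivAt (fun p : ℝ × ℝ × ℝ => deriv V p.1)
        (deriv (deriv V) φ₀ • ContinuousLinearMap.fst ℝ ℝ (ℝ × ℝ)) (φ₀, 0, 0) :=
      HasDerivAt.comp_hasFDerivAt (h₂ := deriv V) (φ₀, 0, 0) (hddV φ₀).hasDerivAt h0
    have hS' := hS.hasFDerivAt
    have key := h1.prodMk ((((hS'.mul h1).sub hD).add (h2.const_mul α)).prodMk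
      (h2.neg.mul ((h1.const_mul α).add (hS'.const_mul γ))))
    refine ⟨_, key.congr_of_eventuallyEq (Filter.Eventually.of_forall fun p => hG p), ?_⟩
    rintro ⟨a, b, c⟩
    ext
    · simp
    · simp
      ring
    · simp
  · generalize deriv (deriv V) φ₀ = k
    have hs : 0 < Real.sqrt (3 * V φ₀) := Real.sqrt_pos.mpr (by linarith)
    generalize Real.sqrt (3 * V φ₀) = s at hs
    obtain ⟨w, hw, hwre⟩ : ∃ w : ℂ, w ^ 2 = (s:ℂ) ^ 2 - 4 * k ∧ 0 ≤ w.re := by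
      obtain ⟨w, hw⟩ := IsAlgClosed.exists_pow_nat_eq ((s:ℂ) ^ 2 - 4 * k) (n := 2) (by norm_num)
      rcases le_total 0 w.re with h | h
      · exact ⟨w, hw, h⟩
      · exact ⟨-w, by rw [neg_sq, hw], by simpa using h⟩
    refine ⟨((s / 2 : ℝ) : ℂ) + ((1 / 2 : ℝ) : ℂ) * w, ?_, ?_⟩
    · rw [Complex.add_re, Complex.re_ofReal_mul, Complex.ofReal_re]
      linarith
    · apply Module.End.hasEigenvalue_of_hasEigenvector
        (x := ![1, ((s / 2 : ℝ) : ℂ) + ((1 / 2 : ℝ) : ℂ) * w, 0])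
      rw [Module.End.hasEigenvector_iff, Module.End.mem_eigenspace_iff]
      constructor
      · rw [Matrix.toLin'_apply]
        ext i
        fin_cases i
        · simp [Matrix.mulVec, dotProduct, Fin.sum_univ_three]
        · simp [Matrix.mulVec, dotProduct, Fin.sum_univ_three]
          linear_combination (-1/4 : ℂ) * hw
        · simp [Matrix.mulVec, dotProduct, Fin.sum_univ_three]
      · intro h
        simpa using congrFun h 0
end

section
/- Let t₀ ∈ ℝ and let H₀ < 0. If T > t₀ and H : [t₀, T] → ℝ is differentiable with H(t₀) = H₀ and H′(t) ≤ −2·H(t)² for all t ∈ [t₀, T], then T < t₀ − 1/(2H₀). Equivalently, no differentiable function on [t₀, t₀ + 1/(2|H₀|)] can satisfy H(t₀) = H₀ < 0 and H′ ≤ −2H² throughout; the solution blows up to −∞ within time 1/(2|H₀|). -/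
/-- the blow-up/comparison argument for the Hubble
function: if `H(t₀) = H₀ < 0` and `H′ ≤ −2H²` on `[t₀, T]`, then
`T < t₀ − 1/(2H₀)`; i.e. `H` blows up to `−∞` within time `1/(2|H₀|)`. -/
theorem stmt_13
    (t₀ H₀ T : ℝ) (hH₀ : H₀ < 0) (hT : t₀ < T)
    (H H' : ℝ → ℝ)
    (hHt₀ : H t₀ = H₀)
    (hdiff : ∀ t ∈ Set.Icc t₀ T, HasDerivAt H (H' t) t)
    (hcomp : ∀ t ∈ Set.Icc t₀ T, H' t ≤ -2 * (H t)^2) :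
    T < t₀ - 1 / (2 * H₀) := by
  have hcont : ContinuousOn H (Set.Icc t₀ T) := fun t ht =>
    (hdiff t ht).continuousAt.continuousWithinAt
  have hanti : AntitoneOn H (Set.Icc t₀ T) := by
    apply antitoneOn_of_hasDerivWithinAt_nonpos (f' := H') (convex_Icc t₀ T) hcont
    · intro t ht
      exact (hdiff t (interior_subset ht)).hasDerivWithinAt
    · intro t ht
      nlinarith [hcomp t (interior_subset ht), sq_nonneg (H t)]
  have hneg : ∀ t ∈ Set.Icc t₀ T, H t < 0 := by
    intro t ht
    have h := hanti (Set.left_mem_Icc.2 hT.le) ht ht.1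
    linarith
  have hder : ∀ t ∈ Set.Icc t₀ T,
      HasDerivAt (fun s => (H s)⁻¹ - 2 * s) (-H' t / (H t) ^ 2 - 2 * 1) t := by
    intro t ht
    exact ((hdiff t ht).fun_inv (hneg t ht).ne).sub ((hasDerivAt_id' t).const_mul 2)
  have hmono : MonotoneOn (fun s => (H s)⁻¹ - 2 * s) (Set.Icc t₀ T) := by
    apply monotoneOn_of_hasDerivWithinAt_nonneg
      (f' := fun t => -H' t / (H t) ^ 2 - 2 * 1) (convex_Icc t₀ T)
    · exact fun t ht => (hder t ht).continuousAt.continuousWithinAt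
    · intro t ht
      exact (hder t (interior_subset ht)).hasDerivWithinAt
    · intro t ht
      have h1 := hcomp t (interior_subset ht)
      have h2 : 0 < (H t) ^ 2 := sq_pos_of_neg (hneg t (interior_subset ht))
      have h3 : 2 ≤ -H' t / (H t) ^ 2 := by
        rw [le_div_iff₀ h2]
        linarith
      linarith
  have h := hmono (Set.left_mem_Icc.2 hT.le) (Set.right_mem_Icc.2 hT.le) hT.le
  have hT' : (H T)⁻¹ < 0 := inv_lt_zero.2 (hneg T (Set.right_mem_Icc.2 hT.le))
  simp only [hHt₀] at h
  have e : 1 / (2 * H₀) = H₀⁻¹ / 2 := by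
    field_simp
  rw [e]
  linarith
end

section
/- Let γ ∈ [0,2], T ∈ (0,∞], and let H : [0,T) → ℝ be differentiable with H(0) < 0, φ : [0,T) → ℝ differentiable, and ρ : [0,T) → [0,∞), satisfying H′(t) = −(1/2)·φ̇(t)² − (γ/2)·ρ(t) for all t ∈ [0,T). (Then H′ ≤ 0, so H(t) ≤ H(0) < 0 for all t.) Assume that (φ̇(t)/H(t))² → 6 and ρ(t)/H(t)² → 0 as t → T. Then T < ∞; that is, the solution cannot exist for all comoving time and a singularity forms in finite time. -/
open Real Filter

/-- a collapsing flat FRW solution whose endstate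
satisfies `(φ̇/H)² → 6` and `ρ/H² → 0` as `t → T` cannot exist for all
comoving time: `T < ∞` and the singularity forms in finite time.
Here `T ∈ (0,∞]` is coded as an extended real and `t → T` is the
pullback to `ℝ` of the left-neighbourhood filter of `T` in `EReal`. -/
theorem stmt_14
    (γ : ℝ) (hγ : γ ∈ Set.Icc (0:ℝ) 2)
    (T : EReal) (hT : 0 < T)
    (D : Set ℝ) (hD : D = {t : ℝ | 0 ≤ t ∧ (t : EReal) < T})
    (H H' φ φ' ρ : ℝ → ℝ)
    (hHdiff : ∀ t ∈ D, HasDerivAt H (H' t) t)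
    (hφdiff : ∀ t ∈ D, HasDerivAt φ (φ' t) t)
    (hρnonneg : ∀ t ∈ D, 0 ≤ ρ t)
    (hH0 : H 0 < 0)
    (eqH : ∀ t ∈ D, H' t = -(1/2) * (φ' t)^2 - (γ/2) * ρ t)
    (hlim1 : Tendsto (fun t => (φ' t / H t)^2)
      (Filter.comap (fun t : ℝ => (t : EReal)) (nhdsWithin T (Set.Iio T)))
      (nhds 6))
    (hlim2 : Tendsto (fun t => ρ t / (H t)^2)
      (Filter.comap (fun t : ℝ => (t : EReal)) (nhdsWithin T (Set.Iio T)))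
      (nhds 0)) :
    T < ⊤ := by
  rw [lt_top_iff_ne_top]
  intro hTop
  subst hTop
  have hmem : ∀ t : ℝ, 0 ≤ t → t ∈ D := by
    intro t ht
    rw [hD]
    exact ⟨ht, EReal.coe_lt_top t⟩
  have hle : (atTop : Filter ℝ) ≤
      Filter.comap (fun t : ℝ => (t : EReal)) (nhdsWithin ⊤ (Set.Iio ⊤)) := by
    rw [← Filter.tendsto_iff_comap]
    refine tendsto_nhdsWithin_iff.2 ⟨?_, Eventually.of_forall fun t => EReal.coe_lt_top t⟩
    exact EReal.tendsto_coe_nhds_top_iff.2 tendsto_id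
  have hanti : AntitoneOn H (Set.Ici 0) := by
    apply antitoneOn_of_deriv_nonpos (convex_Ici 0)
    · intro t ht
      exact (hHdiff t (hmem t ht)).continuousAt.continuousWithinAt
    · intro t ht
      exact (hHdiff t (hmem t (interior_subset ht))).differentiableAt.differentiableWithinAt
    · intro t ht
      have h := hmem t (interior_subset ht)
      rw [(hHdiff t h).deriv, eqH t h]
      have := mul_nonneg hγ.1 (hρnonneg t h)
      nlinarith [sq_nonneg (φ' t)]
  have hneg : ∀ t : ℝ, 0 ≤ t → H t < 0 := fun t ht =>
    lt_of_le_of_lt (hanti (Set.mem_Ici.2 le_rfl) ht ht) hH0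
  have hev : ∀ᶠ t in (atTop : Filter ℝ), 2 < (φ' t / H t)^2 :=
    (hlim1.mono_left hle).eventually (lt_mem_nhds (by norm_num))
  obtain ⟨t1, ht1⟩ := eventually_atTop.1 hev
  obtain ⟨t0, ht0, h10⟩ : ∃ t0 : ℝ, 0 ≤ t0 ∧ t1 ≤ t0 :=
    ⟨max 0 t1, le_max_left _ _, le_max_right _ _⟩
  have hder : ∀ t, t0 ≤ t → HasDerivAt (fun s => (H s)⁻¹ - s) (-H' t / (H t)^2 - 1) t := by
    intro t ht
    exact ((hHdiff t (hmem t (ht0.trans ht))).inv (hneg t (ht0.trans ht)).ne).sub (hasDerivAt_id t)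
  have hmono : MonotoneOn (fun s => (H s)⁻¹ - s) (Set.Ici t0) := by
    apply monotoneOn_of_deriv_nonneg (convex_Ici t0)
    · intro t ht
      exact (hder t ht).continuousAt.continuousWithinAt
    · intro t ht
      exact (hder t (interior_subset ht)).differentiableAt.differentiableWithinAt
    · intro t ht
      have ht' : t0 ≤ t := interior_subset ht
      have h := hmem t (ht0.trans ht')
      have hn := hneg t (ht0.trans ht')
      have hpos : 0 < (H t)^2 := by nlinarith
      have h2 := ht1 t (h10.trans ht')
      rw [div_pow, lt_div_iff₀ hpos] at h2
      have h3 := mul_nonneg hγ.1 (hρnonneg t h)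
      rw [(hder t ht').deriv, sub_nonneg, le_div_iff₀ hpos, eqH t h]
      nlinarith
  have hi0 : (H t0)⁻¹ < 0 := inv_lt_zero.2 (hneg t0 ht0)
  have hb : t0 ≤ t0 - (H t0)⁻¹ := by linarith
  have hfin := hmono (Set.mem_Ici.2 le_rfl) (Set.mem_Ici.2 hb) hb
  have hi1 : (H (t0 - (H t0)⁻¹))⁻¹ < 0 := inv_lt_zero.2 (hneg _ (ht0.trans hb))
  simp only at hfin
  linarith
end

section
/- Let T ∈ (0,∞] and let a : [0,T) → ℝ be twice differentiable with a(t) > 0 and a′(t) < 0 for all t, and a(t) → 0 as t → T. Suppose there is t₀ ∈ [0,T) such that a″(t)·a(t) ≤ −a′(t)² for all t ∈ [t₀, T) (i.e., the ratio (ä/ȧ)/(ȧ/a) is at most −1 from time t₀ on). Then a′(t) → −∞ as t → T. (In the collapsing star model this is the statement that ȧ diverges, the trapped region forms, and the collapse ends in a black hole.) -/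
open Real Filter

/-- black hole formation criterion.  If the scale factor
`a` of a collapsing model (`a > 0`, `ȧ < 0`, `a → 0` as `t → T`)
eventually satisfies `ä·a ≤ −ȧ²`, then `ȧ → −∞` as `t → T` (the
trapped region forms and the collapse ends in a black hole).
Here `T ∈ (0,∞]` is coded as an extended real and `t → T` is the
pullback to `ℝ` of the left-neighbourhood filter of `T` in `EReal`. -/
theorem stmt_15
    (T : EReal) (hT : 0 < T)
    (D : Set ℝ) (hD : D = {t : ℝ | 0 ≤ t ∧ (t : EReal) < T})
    (a a' a'' : ℝ → ℝ)
    (hadiff : ∀ t ∈ D, HasDerivAt a (a' t) t)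
    (hadiff2 : ∀ t ∈ D, HasDerivAt a' (a'' t) t)
    (hapos : ∀ t ∈ D, 0 < a t)
    (haneg : ∀ t ∈ D, a' t < 0)
    (ha0 : Tendsto a
      (Filter.comap (fun t : ℝ => (t : EReal)) (nhdsWithin T (Set.Iio T)))
      (nhds 0))
    (t₀ : ℝ) (ht₀ : t₀ ∈ D)
    (hineq : ∀ t ∈ D, t₀ ≤ t → a'' t * a t ≤ -(a' t)^2) :
    Tendsto a'
      (Filter.comap (fun t : ℝ => (t : EReal)) (nhdsWithin T (Set.Iio T)))
      atBot := by
  subst hD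
  have hanti : AntitoneOn (fun t => a t * a' t) ({t : ℝ | t₀ ≤ t ∧ (t : EReal) < T}) := by
    have hder : ∀ t ∈ {t : ℝ | t₀ ≤ t ∧ (t : EReal) < T},
        HasDerivAt (fun t => a t * a' t) (a' t * a' t + a t * a'' t) t := by
      intro t ht
      have htD : t ∈ {t : ℝ | 0 ≤ t ∧ (t : EReal) < T} := ⟨ht₀.1.trans ht.1, ht.2⟩
      exact (hadiff t htD).mul (hadiff2 t htD)
    apply antitoneOn_of_deriv_nonpos
    · apply Set.OrdConnected.convex
      refine ⟨fun x hx y hy z hz => ⟨hx.1.trans hz.1, ?_⟩⟩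
      exact lt_of_le_of_lt (EReal.coe_le_coe_iff.2 hz.2) hy.2
    · exact fun t ht => (hder t ht).continuousAt.continuousWithinAt
    · exact fun t ht => (hder t (interior_subset ht)).differentiableAt.differentiableWithinAt
    · intro t ht
      have ht' := interior_subset ht
      rw [(hder t ht').deriv]
      have := hineq t ⟨ht₀.1.trans ht'.1, ht'.2⟩ ht'.1
      nlinarith
  have hev : ∀ᶠ t in Filter.comap (fun t : ℝ => (t : EReal)) (nhdsWithin T (Set.Iio T)),
      t₀ ≤ t ∧ (t : EReal) < T := by
    have h : Set.Ioo (t₀ : EReal) T ∈ nhdsWithin T (Set.Iio T) := Ioo_mem_nhdsLT ht₀.2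
    filter_upwards [Filter.preimage_mem_comap h] with t ht
    exact ⟨(EReal.coe_lt_coe_iff.1 ht.1).le, ht.2⟩
  have hc : a t₀ * a' t₀ < 0 := mul_neg_of_pos_of_neg (hapos _ ht₀) (haneg _ ht₀)
  have hinv : Tendsto (fun t => (a t)⁻¹)
      (Filter.comap (fun t : ℝ => (t : EReal)) (nhdsWithin T (Set.Iio T))) atTop := by
    apply Tendsto.comp tendsto_inv_nhdsGT_zero
    refine tendsto_nhdsWithin_iff.2 ⟨ha0, ?_⟩
    filter_upwards [hev] with t ht
    exact hapos t ⟨ht₀.1.trans ht.1, ht.2⟩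
  refine tendsto_atBot_mono' _ ?_ (hinv.const_mul_atTop_of_neg hc)
  filter_upwards [hev] with t ht
  have hp := hapos t ⟨ht₀.1.trans ht.1, ht.2⟩
  have h : a t * a' t ≤ a t₀ * a' t₀ := hanti ⟨le_rfl, ht₀.2⟩ ht ht.1
  rw [← div_eq_mul_inv, le_div_iff₀ hp]
  linarith
end

section
/- Let T ∈ (0,∞] and let a : [0,T) → ℝ be twice differentiable with a(t) > 0 and a′(t) < 0 for all t, and a(t) → 0 as t → T. Suppose there are t₀ ∈ [0,T) and a constant c > 0 such that a″(t)·a(t) ≥ c·a′(t)² for all t ∈ [t₀, T) (i.e., the ratio (ä/ȧ)/(ȧ/a) is at least c from time t₀ on). Then a′(t) → 0 as t → T; in particular ȧ remains bounded. (In the collapsing star model this is the criterion under which the apparent horizon never forms and the singularity is naked.) -/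
open Real Filter

/-- naked singularity criterion.  If the scale factor
`a` of a collapsing model (`a > 0`, `ȧ < 0`, `a → 0` as `t → T`)
eventually satisfies `ä·a ≥ c·ȧ²` for some constant `c > 0`, then
`ȧ → 0` as `t → T`; in particular `ȧ` stays bounded and the apparent
horizon never forms.  Here `T ∈ (0,∞]` is coded as an extended real
and `t → T` is the pullback to `ℝ` of the left-neighbourhood filter
of `T` in `EReal`. -/
theorem stmt_16
    (T : EReal) (hT : 0 < T)
    (D : Set ℝ) (hD : D = {t : ℝ | 0 ≤ t ∧ (t : EReal) < T})
    (a a' a'' : ℝ → ℝ)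
    (hadiff : ∀ t ∈ D, HasDerivAt a (a' t) t)
    (hadiff2 : ∀ t ∈ D, HasDerivAt a' (a'' t) t)
    (hapos : ∀ t ∈ D, 0 < a t)
    (haneg : ∀ t ∈ D, a' t < 0)
    (ha0 : Tendsto a
      (Filter.comap (fun t : ℝ => (t : EReal)) (nhdsWithin T (Set.Iio T)))
      (nhds 0))
    (t₀ : ℝ) (ht₀ : t₀ ∈ D)
    (c : ℝ) (hc : 0 < c)
    (hineq : ∀ t ∈ D, t₀ ≤ t → c * (a' t)^2 ≤ a'' t * a t) :
    Tendsto a'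
      (Filter.comap (fun t : ℝ => (t : EReal)) (nhdsWithin T (Set.Iio T)))
      (nhds 0) := by
  set S : Set ℝ := {t : ℝ | t₀ ≤ t ∧ (t : EReal) < T} with hS
  have ht0 : 0 ≤ t₀ ∧ (t₀ : EReal) < T := by rw [hD] at ht₀; exact ht₀
  have hSD : ∀ t ∈ S, t ∈ D := by
    intro t ht
    rw [hD]
    exact ⟨ht0.1.trans ht.1, ht.2⟩
  have hconv : Convex ℝ S := by
    apply Set.OrdConnected.convex
    refine ⟨fun x hx y hy z hz => ⟨hx.1.trans hz.1, lt_of_le_of_lt ?_ hy.2⟩⟩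
    exact_mod_cast hz.2
  have hder : ∀ t ∈ S, HasDerivAt (fun s => -a' s * (a s) ^ (-c))
      (-a'' t * (a t) ^ (-c) + -a' t * (a' t * (-c) * (a t) ^ (-c - 1))) t := by
    intro t ht
    have hd := hSD t ht
    exact (hadiff2 t hd).neg.mul ((hadiff t hd).rpow_const (Or.inl (hapos t hd).ne'))
  have hanti : AntitoneOn (fun s => -a' s * (a s) ^ (-c)) S := by
    apply antitoneOn_of_hasDerivWithinAt_nonpos hconv
      (fun t ht => (hder t ht).continuousAt.continuousWithinAt)
      (fun t ht => (hder t (interior_subset ht)).hasDerivWithinAt)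
    intro t ht
    have ht := interior_subset ht
    have hp := hapos t (hSD t ht)
    have h1 : (a t) ^ (-c) = (a t) ^ (-c - 1) * a t := by
      rw [Real.rpow_sub_one hp.ne']
      field_simp
    have h2 := hineq t (hSD t ht) ht.1
    have h3 : 0 < (a t) ^ (-c - 1) := Real.rpow_pos_of_pos hp _
    rw [h1]
    nlinarith [mul_le_mul_of_nonneg_left h2 h3.le]
  have hmem : ∀ᶠ t in Filter.comap (fun t : ℝ => (t : EReal)) (nhdsWithin T (Set.Iio T)),
      t ∈ S := by
    have h : Set.Ioo (t₀ : EReal) T ∈ nhdsWithin T (Set.Iio T) := Ioo_mem_nhdsLT ht0.2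
    filter_upwards [preimage_mem_comap h] with t ht
    exact ⟨EReal.coe_le_coe_iff.mp ht.1.le, ht.2⟩
  have hlim : Tendsto (fun t => -((-a' t₀ * (a t₀) ^ (-c)) * (a t) ^ c))
      (Filter.comap (fun t : ℝ => (t : EReal)) (nhdsWithin T (Set.Iio T))) (nhds 0) := by
    have h := ((ha0.rpow_const (p := c) (Or.inr hc.le)).const_mul
      (-a' t₀ * (a t₀) ^ (-c))).neg
    simpa [Real.zero_rpow hc.ne'] using h
  refine tendsto_of_tendsto_of_tendsto_of_le_of_le' hlim tendsto_const_nhds ?_ ?_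
  · filter_upwards [hmem] with t ht
    have h := hanti (show t₀ ∈ S from ⟨le_rfl, ht0.2⟩) ht ht.1
    have hp := hapos t (hSD t ht)
    have h4 : 0 < (a t) ^ c := Real.rpow_pos_of_pos hp _
    have h5 : (a t) ^ (-c) * (a t) ^ c = 1 := by
      rw [← Real.rpow_add hp]; simp
    have h6 := mul_le_mul_of_nonneg_right h h4.le
    simp only [mul_assoc, h5] at h6 ⊢
    linarith
  · filter_upwards [hmem] with t ht
    exact (haneg t (hSD t ht)).le
end
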